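/- Suppose α is an isophote with axis d and angle θ with sin θ ≠ 0, and k_n(s)² + τ_g(s)² > 0 for all s. Then ⟪T(s), d⟫ = 0 for all s (the axis d is perpendicular to the tangent line of α) if and only if τ_g(s) = 0 for all s (α is a line of curvature). -/

import Mathlib

open scoped RealInnerProductSpace

noncomputable section

/-- The cross product on `EuclideanSpace ℝ (Fin 3)`. -/
def cross3 (u v : EuclideanSpace ℝ (Fin 3)) : EuclideanSpace ℝ (Fin 3) :=
  (EuclideanSpace.equiv (Fin 3) ℝ).symm
    (crossProduct ((EuclideanSpace.equiv (Fin 3) ℝ) u) ((EuclideanSpace.equiv (Fin 3) ℝ) v))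

@[simp]
lemma cross3_apply_zero (u v : EuclideanSpace ℝ (Fin 3)) :
    cross3 u v 0 = u 1 * v 2 - u 2 * v 1 := by
  simp [cross3, cross_apply]

@[simp]
lemma cross3_apply_one (u v : EuclideanSpace ℝ (Fin 3)) :
    cross3 u v 1 = u 2 * v 0 - u 0 * v 2 := by
  simp [cross3, cross_apply]

@[simp]
lemma cross3_apply_two (u v : EuclideanSpace ℝ (Fin 3)) :
    cross3 u v 2 = u 0 * v 1 - u 1 * v 0 := by
  simp [cross3, cross_apply]

lemma inner_self_cross3 (u v : EuclideanSpace ℝ (Fin 3)) : ⟪u, cross3 u v⟫ = 0 := by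
  simp only [PiLp.inner_apply, Fin.sum_univ_three, RCLike.inner_apply, conj_trivial,
    cross3_apply_zero, cross3_apply_one, cross3_apply_two]
  ring

lemma inner_cross3_self (u v : EuclideanSpace ℝ (Fin 3)) : ⟪v, cross3 u v⟫ = 0 := by
  simp only [PiLp.inner_apply, Fin.sum_univ_three, RCLike.inner_apply, conj_trivial,
    cross3_apply_zero, cross3_apply_one, cross3_apply_two]
  ring

lemma norm_cross3_sq (u v : EuclideanSpace ℝ (Fin 3)) :
    ‖cross3 u v‖ ^ 2 = ‖u‖ ^ 2 * ‖v‖ ^ 2 - ⟪u, v⟫ ^ 2 := by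
  simp only [← real_inner_self_eq_norm_sq, PiLp.inner_apply, Fin.sum_univ_three,
    RCLike.inner_apply, conj_trivial, cross3_apply_zero, cross3_apply_one, cross3_apply_two]
  ring

lemma Differentiable.cross3 {f g : ℝ → EuclideanSpace ℝ (Fin 3)}
    (hf : Differentiable ℝ f) (hg : Differentiable ℝ g) :
    Differentiable ℝ fun s => cross3 (f s) (g s) := by
  rw [differentiable_euclidean] at hf hg ⊢
  intro i
  fin_cases i
  · simp only [Fin.zero_eta, cross3_apply_zero]
    exact ((hf 1).mul (hg 2)).sub ((hf 2).mul (hg 1))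
  · simp only [Fin.mk_one, cross3_apply_one]
    exact ((hf 2).mul (hg 0)).sub ((hf 0).mul (hg 2))
  · simp only [Fin.reduceFinMk, cross3_apply_two]
    exact ((hf 0).mul (hg 1)).sub ((hf 1).mul (hg 0))

/-- Parseval's identity in the orthonormal frame `u, v, u × v`. -/
lemma inner_eq_of_orthonormal_cross3 {u v : EuclideanSpace ℝ (Fin 3)}
    (hu : ‖u‖ = 1) (hv : ‖v‖ = 1) (huv : ⟪u, v⟫ = 0) (x y : EuclideanSpace ℝ (Fin 3)) :
    ⟪x, y⟫ = ⟪x, u⟫ * ⟪u, y⟫ + ⟪x, v⟫ * ⟪v, y⟫ + ⟪x, cross3 u v⟫ * ⟪cross3 u v, y⟫ := by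
  have hw : ‖cross3 u v‖ = 1 := by
    have h := norm_cross3_sq u v
    rw [hu, hv, huv] at h
    nlinarith [norm_nonneg (cross3 u v)]
  have hon : Orthonormal ℝ ![u, v, cross3 u v] := by
    refine ⟨fun i => by fin_cases i <;> simp [hu, hv, hw], fun i j hij => ?_⟩
    have h₁ := inner_self_cross3 u v
    have h₂ := inner_cross3_self u v
    fin_cases i <;> fin_cases j <;>
      first
        | exact absurd rfl hij
        | simpa
        | simpa [real_inner_comm]
  have hcard : Fintype.card (Fin 3) = Module.finrank ℝ (EuclideanSpace ℝ (Fin 3)) := by simp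
  let b := (basisOfOrthonormalOfCardEqFinrank hon hcard).toOrthonormalBasis (by simpa using hon)
  have hb : ⇑b = ![u, v, cross3 u v] := by simp [b]
  rw [← b.sum_inner_mul_inner x y, Fin.sum_univ_three, hb]
  simp

/-- Differentiating a constant inner product moves the derivative to the other factor. -/
lemma inner_deriv_eq_neg_of_inner_const {E : Type*} [NormedAddCommGroup E] [InnerProductSpace ℝ E]
    {f g : ℝ → E} (hf : Differentiable ℝ f) (hg : Differentiable ℝ g) {c : ℝ}
    (h : ∀ s, ⟪f s, g s⟫ = c) (s : ℝ) : ⟪deriv f s, g s⟫ = -⟪deriv g s, f s⟫ := by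
  have hd := deriv_inner_apply ℝ (hf s) (hg s)
  rw [funext h, deriv_const, real_inner_comm (deriv g s)] at hd
  linarith [hd]

theorem stmt7
    (α N : ℝ → EuclideanSpace ℝ (Fin 3))
    (hα : ContDiff ℝ (⊤ : ℕ∞) α) (hN : ContDiff ℝ (⊤ : ℕ∞) N)
    (hunit : ∀ s, ‖deriv α s‖ = 1)
    (hNunit : ∀ s, ‖N s‖ = 1)
    (hNT : ∀ s, ⟪N s, deriv α s⟫ = 0)
    (T B : ℝ → EuclideanSpace ℝ (Fin 3))
    (hT : ∀ s, T s = deriv α s)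
    (hB : ∀ s, B s = cross3 (N s) (T s))
    (kn kg τg : ℝ → ℝ)
    (hkn : ∀ s, kn s = ⟪deriv T s, N s⟫)
    (hkg : ∀ s, kg s = ⟪deriv T s, B s⟫)
    (hτg : ∀ s, τg s = ⟪deriv B s, N s⟫)
    (d : EuclideanSpace ℝ (Fin 3)) (hd : ‖d‖ = 1) (θ : ℝ)
    (hiso : ∀ s, ⟪N s, d⟫ = Real.cos θ)
    (hsin : Real.sin θ ≠ 0)
    (hpos : ∀ s, 0 < kn s ^ 2 + τg s ^ 2) :
    (∀ s, ⟪T s, d⟫ = 0) ↔ (∀ s, τg s = 0) := by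
  obtain rfl : T = deriv α := funext hT
  obtain rfl : B = fun s => cross3 (N s) (deriv α s) := funext hB
  have hNd : Differentiable ℝ N := hN.differentiable (by simp)
  have hTd : Differentiable ℝ (deriv α) :=
    (contDiff_infty_iff_deriv.1 hα).2.differentiable (by simp)
  have hBd := hNd.cross3 hTd
  have hN'T (s) : ⟪deriv N s, deriv α s⟫ = -kn s := by
    rw [hkn, inner_deriv_eq_neg_of_inner_const hNd hTd hNT]
  have hN'B (s) : ⟪deriv N s, cross3 (N s) (deriv α s)⟫ = -τg s := by
    rw [hτg]
    exact inner_deriv_eq_neg_of_inner_const hNd hBd (fun s => inner_self_cross3 _ _) s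
  have hN'N (s) : ⟪deriv N s, N s⟫ = 0 := by
    have h := inner_deriv_eq_neg_of_inner_const hNd hNd (c := 1) (fun s => by simp [hNunit]) s
    linarith
  have hN'd (s) : ⟪deriv N s, d⟫ = 0 := by
    simpa using inner_deriv_eq_neg_of_inner_const hNd (differentiable_const d) hiso s
  have hframe (s) := inner_eq_of_orthonormal_cross3 (hNunit s) (hunit s) (hNT s)
  have hrel (s) : kn s * ⟪deriv α s, d⟫ + τg s * ⟪cross3 (N s) (deriv α s), d⟫ = 0 := by
    have h := hframe s (deriv N s) d
    rw [hN'd, hN'N, hN'T, hN'B] at h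
    linarith
  constructor
  · intro h s
    have hdd := hframe s d d
    have hr := hrel s
    rw [real_inner_self_eq_norm_sq, hd, real_inner_comm, real_inner_comm (deriv α s),
      real_inner_comm (cross3 _ _), hiso, h] at hdd
    rw [h, mul_zero, zero_add] at hr
    refine (mul_eq_zero.1 hr).resolve_right fun h₀ => hsin ?_
    rw [h₀] at hdd
    nlinarith [Real.sin_sq_add_cos_sq θ]
  · intro h s
    have hr := hrel s
    have hk := hpos s
    rw [h, zero_mul, add_zero] at hr
    refine (mul_eq_zero.1 hr).resolve_left fun h₀ => ?_
    simp [h, h₀] at hk
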